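/- Let G = SO(2n+1) and V its defining representation. Then Λⁿ V is a direct summand of V ⊗ Λⁿ V as SO(2n+1)-representations, since Λ^{n+1}V is a summand of V ⊗ Λⁿ V and Λ^{n+1}V ≅ Λⁿ V. -/

import Mathlib

open ExteriorAlgebra TensorProduct Matrix

noncomputable section

theorem wedge_mem {R V : Type*} [CommRing R] [AddCommGroup V] [Module R V]
    (k : ℕ) (v : V) (ω : ⋀[R]^k V) :
    ExteriorAlgebra.ι R v * (ω : ExteriorAlgebra R V) ∈ ⋀[R]^(k+1) V := by
  show _ ∈ LinearMap.range (ExteriorAlgebra.ι R (M := V)) ^ (k + 1)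
  rw [pow_succ']
  exact Submodule.mul_mem_mul (LinearMap.mem_range_self _ v) ω.2

theorem map_exteriorPower_mem {R V : Type*} [CommRing R] [AddCommGroup V] [Module R V]
    (g : V →ₗ[R] V) {k : ℕ} {x : ExteriorAlgebra R V}
    (hx : x ∈ ⋀[R]^k V) : ExteriorAlgebra.map g x ∈ ⋀[R]^k V := by
  have h1 : Submodule.map (ExteriorAlgebra.map g).toLinearMap
      (LinearMap.range (ExteriorAlgebra.ι R (M := V)))
      ≤ LinearMap.range (ExteriorAlgebra.ι R (M := V)) := by
    rintro _ ⟨_, ⟨v, rfl⟩, rfl⟩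
    exact ⟨g v, (map_apply_ι g v).symm⟩
  have h2 := Submodule.map_pow (M := LinearMap.range (ExteriorAlgebra.ι R (M := V)))
      (ExteriorAlgebra.map g) k
  have h3 : Submodule.map (ExteriorAlgebra.map g).toLinearMap (⋀[R]^k V) ≤ ⋀[R]^k V := by
    show Submodule.map _ (LinearMap.range (ExteriorAlgebra.ι R (M := V)) ^ k) ≤ _
    rw [h2]
    exact pow_le_pow_left' h1 k
  exact h3 ⟨x, hx, rfl⟩

/-- The linear map `Λᵏ V → Λᵏ V` induced functorially by `g : V →ₗ[R] V`. -/
def expPowMap {R V : Type*} [CommRing R] [AddCommGroup V] [Module R V]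
    (g : V →ₗ[R] V) (k : ℕ) : ⋀[R]^k V →ₗ[R] ⋀[R]^k V :=
  (ExteriorAlgebra.map g).toLinearMap.restrict fun _ hx => map_exteriorPower_mem g hx



namespace SOaux

abbrev E (N : ℕ) (i : Fin N) : Fin N → ℂ := Pi.single i 1

def vol (N : ℕ) : ExteriorAlgebra ℂ (Fin N → ℂ) →ₗ[ℂ] ℂ :=
  ExteriorAlgebra.liftAlternating
    (Pi.single (M := fun k => (Fin N → ℂ) [⋀^Fin k]→ₗ[ℂ] ℂ) N Matrix.detRowAlternating)

theorem vol_top (N : ℕ) (v : Fin N → Fin N → ℂ) :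
    vol N (ExteriorAlgebra.ιMulti ℂ N v) = Matrix.det v := by
  rw [vol, ExteriorAlgebra.liftAlternating_apply_ιMulti, Pi.single_eq_same]
  rfl

theorem vol_map {N : ℕ} (G : Matrix (Fin N) (Fin N) ℂ) (hG : G.det = 1)
    (x : ExteriorAlgebra ℂ (Fin N → ℂ)) :
    vol N (ExteriorAlgebra.map (Matrix.toLin' G) x) = vol N x := by
  suffices h : vol N ∘ₗ (ExteriorAlgebra.map (Matrix.toLin' G)).toLinearMap = vol N from
    LinearMap.congr_fun h x
  apply ExteriorAlgebra.lhom_ext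
  intro k
  ext v
  simp only [LinearMap.compAlternatingMap_apply, LinearMap.comp_apply, AlgHom.toLinearMap_apply,
    ExteriorAlgebra.map_apply_ιMulti]
  by_cases hk : k = N
  · subst hk
    rw [vol_top, vol_top]
    have : (Matrix.toLin' G ∘ v : Fin k → Fin k → ℂ) = (Matrix.of v * Gᵀ : Matrix _ _ ℂ) := by
      ext i j
      simp [Matrix.mul_apply, Matrix.mulVec, dotProduct, mul_comm]
    rw [this, Matrix.det_mul, Matrix.det_transpose, hG, mul_one]
    rfl
  · rw [vol, ExteriorAlgebra.liftAlternating_apply_ιMulti,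
      ExteriorAlgebra.liftAlternating_apply_ιMulti, Pi.single_eq_of_ne hk]
    rfl

theorem toLin_E {N : ℕ} (G : Matrix (Fin N) (Fin N) ℂ) (a : Fin N) :
    Matrix.toLin' G (E N a) = ∑ b, G b a • E N b := by
  ext j
  simp [E, Pi.single_apply, Finset.sum_apply]

theorem inv_one {N : ℕ} {Y : Type*} [AddCommGroup Y] [Module ℂ Y]
    (G : Matrix (Fin N) (Fin N) ℂ) (hG : G * Gᵀ = 1)
    (β : (Fin N → ℂ) →ₗ[ℂ] (Fin N → ℂ) →ₗ[ℂ] Y) :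
    ∑ a, β (Matrix.toLin' G (E N a)) (Matrix.toLin' G (E N a)) = ∑ a, β (E N a) (E N a) := by
  have hh : ∀ b c, ∑ a, G b a * G c a = if b = c then 1 else 0 := by
    intro b c
    have := congrFun (congrFun hG b) c
    simpa [Matrix.mul_apply, Matrix.one_apply] using this
  simp only [toLin_E, map_sum, LinearMap.sum_apply, map_smul, LinearMap.smul_apply, Finset.smul_sum, smul_smul]
  rw [Finset.sum_comm]
  conv_lhs => enter [2, b]; rw [Finset.sum_comm]
  simp_rw [← Finset.sum_smul]
  simp only [hh]
  simp

theorem inv_multi {N n : ℕ} {X Y : Type*} [AddCommGroup Y] [Module ℂ Y]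
    [AddCommGroup X] [Module ℂ X]
    (G : Matrix (Fin N) (Fin N) ℂ) (hG : G * Gᵀ = 1)
    (F : MultilinearMap ℂ (fun _ : Fin n => (Fin N → ℂ)) X)
    (β : X →ₗ[ℂ] X →ₗ[ℂ] Y) :
    ∑ f : Fin n → Fin N, β (F fun j => Matrix.toLin' G (E N (f j)))
      (F fun j => Matrix.toLin' G (E N (f j)))
      = ∑ f : Fin n → Fin N, β (F fun j => E N (f j)) (F fun j => E N (f j)) := by
  have hh : ∀ b c, ∑ a, G b a * G c a = if b = c then 1 else 0 := by
    intro b c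
    have := congrFun (congrFun hG b) c
    simpa [Matrix.mul_apply, Matrix.one_apply] using this
  have hp : ∀ b c : Fin n → Fin N, ∑ f : Fin n → Fin N,
      (∏ j, G (b j) (f j)) * (∏ j, G (c j) (f j)) = if b = c then 1 else 0 := by
    intro b c
    simp_rw [← Finset.prod_mul_distrib]
    have := (Finset.prod_univ_sum (fun _ : Fin n => (Finset.univ : Finset (Fin N)))
      (fun j a => G (b j) a * G (c j) a)).symm
    rw [Fintype.piFinset_univ] at this
    rw [this]
    simp_rw [hh]
    by_cases h : b = c
    · subst h; simp
    · rw [if_neg h]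
      obtain ⟨j, hj⟩ := Function.ne_iff.1 h
      exact Finset.prod_eq_zero (Finset.mem_univ j) (if_neg hj)
  simp only [toLin_E, MultilinearMap.map_sum, MultilinearMap.map_smul_univ, map_sum,
    LinearMap.sum_apply, map_smul, LinearMap.smul_apply, Finset.smul_sum, smul_smul]
  rw [Finset.sum_comm]
  conv_lhs => enter [2, b]; rw [Finset.sum_comm]
  simp_rw [← Finset.sum_smul, hp]
  simp

/-- basis monomials -/
def W (N n : ℕ) (f : Fin n → Fin N) : ⋀[ℂ]^n (Fin N → ℂ) :=
  exteriorPower.ιMulti ℂ n fun j => E N (f j)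

theorem expPow_ιMulti {N n : ℕ} (g : (Fin N → ℂ) →ₗ[ℂ] (Fin N → ℂ)) (v : Fin n → Fin N → ℂ) :
    expPowMap g n (exteriorPower.ιMulti ℂ n v) = exteriorPower.ιMulti ℂ n (fun j => g (v j)) := by
  apply Subtype.ext
  exact ExteriorAlgebra.map_apply_ιMulti g v

theorem inv_W {N n : ℕ} {Y : Type*} [AddCommGroup Y] [Module ℂ Y]
    (G : Matrix (Fin N) (Fin N) ℂ) (hG : G * Gᵀ = 1)
    (β : (⋀[ℂ]^n (Fin N → ℂ)) →ₗ[ℂ] (⋀[ℂ]^n (Fin N → ℂ)) →ₗ[ℂ] Y) :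
    ∑ f, β (expPowMap (Matrix.toLin' G) n (W N n f)) (expPowMap (Matrix.toLin' G) n (W N n f))
      = ∑ f, β (W N n f) (W N n f) := by
  simp only [W, expPow_ιMulti]
  exact inv_multi G hG (exteriorPower.ιMulti ℂ n).toMultilinearMap β

/-- The trilinear form `vol (v ∧ x ∧ y)`. -/
def tri (N n : ℕ) : (Fin N → ℂ) →ₗ[ℂ] (⋀[ℂ]^n (Fin N → ℂ)) →ₗ[ℂ] (⋀[ℂ]^n (Fin N → ℂ)) →ₗ[ℂ] ℂ :=
  LinearMap.mk₂ ℂ (fun v x => vol N ∘ₗ LinearMap.mulLeft ℂ (ExteriorAlgebra.ι ℂ v * x.1) ∘ₗ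
      Submodule.subtype _)
    (by intros; ext; simp [add_mul, mul_assoc]) (by intros; ext; simp [mul_assoc])
    (by intros; ext; simp [add_mul, mul_add, mul_assoc]) (by intros; ext; simp [mul_assoc])

theorem tri_apply {N n : ℕ} (v : Fin N → ℂ) (x y : ⋀[ℂ]^n (Fin N → ℂ)) :
    tri N n v x y = vol N (ExteriorAlgebra.ι ℂ v * x.1 * y.1) := rfl

theorem tri_map {N n : ℕ} (G : Matrix (Fin N) (Fin N) ℂ) (hG : G.det = 1)
    (v : Fin N → ℂ) (x y : ⋀[ℂ]^n (Fin N → ℂ)) :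
    tri N n (Matrix.toLin' G v) (expPowMap (Matrix.toLin' G) n x)
      (expPowMap (Matrix.toLin' G) n y) = tri N n v x y := by
  rw [tri_apply, tri_apply, ← vol_map G hG (ExteriorAlgebra.ι ℂ v * x.1 * y.1), map_mul (ExteriorAlgebra.map _),
    map_mul (ExteriorAlgebra.map _), ExteriorAlgebra.map_apply_ι]
  rfl

def phi (N n : ℕ) : (Fin N → ℂ) ⊗[ℂ] (⋀[ℂ]^n (Fin N → ℂ)) →ₗ[ℂ] ⋀[ℂ]^n (Fin N → ℂ) :=
  TensorProduct.lift (LinearMap.mk₂ ℂ (fun v x => ∑ f, tri N n v x (W N n f) • W N n f)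
    (by intros; simp [add_smul, Finset.sum_add_distrib])
    (by intros; simp [Finset.smul_sum, smul_smul])
    (by intros; simp [add_smul, Finset.sum_add_distrib])
    (by intros; simp [Finset.smul_sum, smul_smul]))

theorem phi_tmul {N n : ℕ} (v : Fin N → ℂ) (x : ⋀[ℂ]^n (Fin N → ℂ)) :
    phi N n (v ⊗ₜ x) = ∑ f, tri N n v x (W N n f) • W N n f := rfl

def sec (N n : ℕ) : (⋀[ℂ]^n (Fin N → ℂ)) →ₗ[ℂ] (Fin N → ℂ) ⊗[ℂ] (⋀[ℂ]^n (Fin N → ℂ)) where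
  toFun x := ∑ i, ∑ f, tri N n (E N i) (W N n f) x • (E N i ⊗ₜ[ℂ] W N n f)
  map_add' := by intros; simp [add_smul, Finset.sum_add_distrib]
  map_smul' := by intros; simp [Finset.smul_sum, smul_smul]

theorem sec_apply {N n : ℕ} (x : ⋀[ℂ]^n (Fin N → ℂ)) :
    sec N n x = ∑ i, ∑ f, tri N n (E N i) (W N n f) x • (E N i ⊗ₜ[ℂ] W N n f) := rfl

theorem phi_equiv {N n : ℕ} (G : Matrix (Fin N) (Fin N) ℂ) (hG : G.det = 1) (hG' : G * Gᵀ = 1)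
    (v : Fin N → ℂ) (x : ⋀[ℂ]^n (Fin N → ℂ)) :
    phi N n (Matrix.toLin' G v ⊗ₜ expPowMap (Matrix.toLin' G) n x) =
      expPowMap (Matrix.toLin' G) n (phi N n (v ⊗ₜ x)) := by
  rw [phi_tmul, phi_tmul]
  have := inv_W G hG' (LinearMap.lsmul ℂ (⋀[ℂ]^n (Fin N → ℂ)) ∘ₗ
      tri N n (Matrix.toLin' G v) (expPowMap (Matrix.toLin' G) n x))
  simp only [LinearMap.comp_apply, LinearMap.lsmul_apply] at this
  rw [← this, map_sum]
  simp only [tri_map G hG, map_smul]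

theorem sec_equiv {N n : ℕ} (G : Matrix (Fin N) (Fin N) ℂ) (hG : G.det = 1) (hG' : G * Gᵀ = 1)
    (x : ⋀[ℂ]^n (Fin N → ℂ)) :
    sec N n (expPowMap (Matrix.toLin' G) n x) =
      TensorProduct.map (Matrix.toLin' G) (expPowMap (Matrix.toLin' G) n) (sec N n x) := by
  rw [sec_apply, sec_apply]
  set x' := expPowMap (Matrix.toLin' G) n x with hx'
  have h1 : ∀ v w : Fin N → ℂ, ∑ f, tri N n v (W N n f) x' • (w ⊗ₜ[ℂ] W N n f) =
      ∑ f, tri N n v (expPowMap (Matrix.toLin' G) n (W N n f)) x' •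
        (w ⊗ₜ[ℂ] expPowMap (Matrix.toLin' G) n (W N n f)) := by
    intro v w
    have := inv_W G hG' (LinearMap.mk₂ ℂ (fun a b => tri N n v a x' • (w ⊗ₜ[ℂ] b))
      (by intros; simp [add_smul]) (by intros; simp [smul_smul])
      (by intros; simp [TensorProduct.tmul_add]) (by intros; simp [smul_smul, mul_comm]))
    simpa only [LinearMap.mk₂_apply] using this.symm
  have h2 := inv_one G hG' (LinearMap.mk₂ ℂ
      (fun v w => ∑ f, tri N n v (W N n f) x' • (w ⊗ₜ[ℂ] W N n f))
      (by intros; simp [add_smul, Finset.sum_add_distrib])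
      (by intros; simp [smul_smul, Finset.smul_sum])
      (by intros; simp [TensorProduct.add_tmul, Finset.sum_add_distrib])
      (by intros; simp [smul_smul, mul_comm, Finset.smul_sum, TensorProduct.smul_tmul']))
  simp only [LinearMap.mk₂_apply] at h2
  rw [← h2]
  simp only [h1]
  simp only [hx', tri_map G hG, map_sum, map_smul, TensorProduct.map_tmul]


/-- The index tuple `(i, f, k)`. -/
def tup {N n : ℕ} (i : Fin N) (f k : Fin n → Fin N) : Fin (1 + n + n) → Fin N :=
  Fin.append (Fin.append ![i] f) k

theorem tri_tup {N n : ℕ} (i : Fin N) (f k : Fin n → Fin N) :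
    tri N n (E N i) (W N n f) (W N n k) =
      vol N (ExteriorAlgebra.ιMulti ℂ (1 + n + n) fun j => E N (tup i f k j)) := by
  have h1 : ExteriorAlgebra.ι ℂ (E N i) = ExteriorAlgebra.ιMulti ℂ 1 ![E N i] := by
    simp
  rw [tri_apply, h1]
  simp only [W, exteriorPower.ιMulti_apply_coe]
  rw [ExteriorAlgebra.ιMulti_mul_ιMulti, ExteriorAlgebra.ιMulti_mul_ιMulti]
  congr 2
  funext j
  refine Fin.addCases (fun j => ?_) (fun j => ?_) j
  · refine Fin.addCases (fun j => ?_) (fun j => ?_) j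
    · simp [tup]
    · simp [tup]
  · simp [tup]

theorem tup_inj_of_ne {N n : ℕ} {i : Fin N} {f k : Fin n → Fin N}
    (h : tri N n (E N i) (W N n f) (W N n k) ≠ 0) : Function.Injective (tup i f k) := by
  by_contra hc
  apply h
  rw [tri_tup, ExteriorAlgebra.ιMulti_eq_zero_of_not_inj, map_zero]
  exact fun hi => hc (Function.Injective.of_comp (f := E N) hi)

theorem vol_sq {N m : ℕ} (hm : m = N) (w : Fin m → Fin N) (hw : Function.Injective w) :
    vol N (ExteriorAlgebra.ιMulti ℂ m fun j => E N (w j)) *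
      vol N (ExteriorAlgebra.ιMulti ℂ m fun j => E N (w j)) = 1 := by
  subst hm
  let σ : Equiv.Perm (Fin m) := Equiv.ofBijective w (Finite.injective_iff_bijective.1 hw)
  have h : ExteriorAlgebra.ιMulti ℂ m (fun j => E m (w j)) =
      Equiv.Perm.sign σ • ExteriorAlgebra.ιMulti ℂ m (E m) :=
    AlternatingMap.map_perm _ (E m) σ
  have h1 : vol m (ExteriorAlgebra.ιMulti ℂ m (E m)) = 1 := by
    rw [vol_top]
    have : (E m : Fin m → Fin m → ℂ) = (1 : Matrix (Fin m) (Fin m) ℂ) := by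
      ext i j
      simp [E, Matrix.one_apply, Pi.single_apply, eq_comm]
    rw [this, Matrix.det_one]
  rw [h]
  rcases Int.units_eq_one_or (Equiv.Perm.sign σ) with h2 | h2 <;> rw [h2] <;> simp [h1]

theorem tri_perm {N n : ℕ} (i : Fin N) (f k : Fin n → Fin N) (σ : Equiv.Perm (Fin n)) :
    tri N n (E N i) (W N n f) (W N n (k ∘ σ)) • W N n (k ∘ σ) =
      tri N n (E N i) (W N n f) (W N n k) • W N n k := by
  have h : W N n (k ∘ σ) = Equiv.Perm.sign σ • W N n k :=
    AlternatingMap.map_perm _ (fun j => E N (k j)) σ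
  rw [h]
  rcases Int.units_eq_one_or (Equiv.Perm.sign σ) with h2 | h2 <;> rw [h2] <;> simp

theorem range_eq {N n : ℕ} (hN : 1 + n + n = N) {i : Fin N} {f k : Fin n → Fin N}
    (h : Function.Injective (tup i f k)) :
    Set.range k = (Set.range (Fin.append ![i] f))ᶜ := by
  have hb : Function.Bijective (tup i f k) := by
    rw [Fintype.bijective_iff_injective_and_card]
    exact ⟨h, by simp [hN]⟩
  obtain ⟨_, _, h3⟩ := Fin.append_injective_iff.1 h
  ext y
  constructor
  · rintro ⟨j, rfl⟩ ⟨l, hl⟩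
    exact h3 l j hl
  · intro hy
    obtain ⟨j, rfl⟩ := hb.2 y
    revert hy
    refine Fin.addCases (fun j => ?_) (fun j => ?_) j
    · intro hy
      exact absurd ⟨j, by simp [tup]⟩ hy
    · intro _
      exact ⟨j, by simp [tup]⟩

theorem exists_perm {n : ℕ} {X : Type*} {k h : Fin n → X} (hk : Function.Injective k)
    (hh : Function.Injective h) (e : Set.range k = Set.range h) :
    ∃ σ : Equiv.Perm (Fin n), h = k ∘ σ := by
  refine ⟨(Equiv.ofInjective h hh).trans
    ((Equiv.setCongr e.symm).trans (Equiv.ofInjective k hk).symm), ?_⟩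
  funext j
  simp [Equiv.apply_ofInjective_symm]

theorem exists_tup {N n : ℕ} (hN : 1 + n + n = N) {k : Fin n → Fin N}
    (hk : Function.Injective k) : ∃ i f, Function.Injective (tup i f k) := by
  classical
  have hc : Fintype.card (Fin (1 + n)) = Fintype.card {x // x ∉ Set.range k} := by
    rw [Fintype.card_subtype_compl]
    have : Fintype.card {x // x ∈ Set.range k} = n := by
      rw [← Fintype.card_congr (Equiv.ofInjective k hk)]; simp
    rw [this]; simp; omega
  let e := Fintype.equivOfCardEq hc
  let u : Fin (1 + n) → Fin N := fun j => (e j).1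
  have hu : Fin.append ![u (Fin.castAdd n 0)] (fun j => u (Fin.natAdd 1 j)) = u := by
    conv_rhs => rw [← Fin.append_castAdd_natAdd (f := u)]
    congr 1
    funext j
    fin_cases j
    rfl
  refine ⟨u (Fin.castAdd n 0), fun j => u (Fin.natAdd 1 j), ?_⟩
  rw [tup, hu, Fin.append_injective_iff]
  refine ⟨Subtype.val_injective.comp e.injective, hk, fun a b hab => ?_⟩
  exact (e a).2 ⟨b, hab.symm⟩

open Classical in
theorem term_eq {N n : ℕ} (hN : 1 + n + n = N) (i : Fin N) (f k h : Fin n → Fin N) :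
    tri N n (E N i) (W N n f) (W N n k) •
      (tri N n (E N i) (W N n f) (W N n h) • W N n h) =
    (if Function.Injective (tup i f k) ∧ Function.Injective (tup i f h) then 1 else 0 : ℕ) •
      W N n k := by
  split_ifs with hc
  · obtain ⟨h1, h2⟩ := hc
    obtain ⟨σ, rfl⟩ := exists_perm (Fin.append_injective_iff.1 h1).2.1
      (Fin.append_injective_iff.1 h2).2.1 ((range_eq hN h1).trans (range_eq hN h2).symm)
    rw [tri_perm, smul_smul, tri_tup, vol_sq hN _ h1, one_smul, one_smul]
  · rw [zero_smul]
    by_contra hne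
    apply hc
    constructor
    · apply tup_inj_of_ne
      intro h0
      rw [h0, zero_smul] at hne
      exact hne rfl
    · apply tup_inj_of_ne
      intro h0
      rw [h0, zero_smul, smul_zero] at hne
      exact hne rfl

theorem phi_sec_W {N n : ℕ} (hN : 1 + n + n = N) (k : Fin n → Fin N) :
    ∃ c : ℕ, (Function.Injective k → c ≠ 0) ∧ phi N n (sec N n (W N n k)) = c • W N n k := by
  classical
  refine ⟨∑ i, ∑ f, ∑ h, if Function.Injective (tup i f k) ∧ Function.Injective (tup i f h)
    then 1 else 0, ?_, ?_⟩
  · intro hk h0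
    obtain ⟨i, f, hif⟩ := exists_tup hN hk
    simp only [Finset.sum_eq_zero_iff, Finset.mem_univ, true_imp_iff] at h0
    have := h0 i f k
    simp [hif] at this
  · rw [sec_apply]
    simp only [map_sum, map_smul, phi_tmul, Finset.smul_sum, Finset.sum_smul, term_eq hN]

theorem span_W (N n : ℕ) : Submodule.span ℂ (Set.range (W N n)) = ⊤ := by
  have hs : Submodule.span ℂ (Set.range (E N)) = ⊤ := by
    have := (Pi.basisFun ℂ (Fin N)).span_eq
    convert this using 3
    funext i
    simp [E]
  rw [← top_le_iff, ← exteriorPower.ιMulti_span_of_span ℂ n _ hs]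
  apply Submodule.span_mono
  rintro _ ⟨a, ha, rfl⟩
  have : ∀ j, ∃ b, E N b = a j := fun j => ha ⟨j, rfl⟩
  choose f hf using this
  exact ⟨f, by simp only [W, hf]⟩

theorem surj {N n : ℕ} (hN : 1 + n + n = N) : Function.Surjective (phi N n ∘ₗ sec N n) := by
  rw [← LinearMap.range_eq_top, ← top_le_iff, ← span_W, Submodule.span_le]
  rintro _ ⟨k, rfl⟩
  obtain ⟨c, hc, h⟩ := phi_sec_W hN k
  by_cases hk : Function.Injective k
  · have hc' : (c : ℂ) ≠ 0 := by exact_mod_cast hc hk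
    refine ⟨(c : ℂ)⁻¹ • W N n k, ?_⟩
    rw [map_smul, LinearMap.comp_apply, h, ← Nat.cast_smul_eq_nsmul ℂ, smul_smul,
      inv_mul_cancel₀ hc', one_smul]
  · have : W N n k = 0 := AlternatingMap.map_eq_zero_of_not_injective _ _
      fun hi => hk (Function.Injective.of_comp (f := E N) hi)
    rw [this]
    exact zero_mem _

end SOaux

/-- The representation-theoretic ingredient ruling out the reflection ambiguity for
`SO(2n+1)`: `Λⁿ V` is a direct summand of `V ⊗ Λⁿ V` as `SO(2n+1)`-representations (where
`V = ℂ^{2n+1}` is the complexified defining representation).  Indeed `Λⁿ⁺¹ V` is a summand of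
`V ⊗ Λⁿ V` via the wedge surjection, and `Λⁿ⁺¹ V ≅ Λⁿ V` by duality.  Concretely: there are an
`SO(2n+1)`-equivariant linear surjection `φ : V ⊗ Λⁿ V → Λⁿ V` and an `SO(2n+1)`-equivariant
linear section `s` of `φ`. -/
theorem stmt_17 (n : ℕ) :
    ∃ φ : (Fin (2 * n + 1) → ℂ) ⊗[ℂ] (⋀[ℂ]^n (Fin (2 * n + 1) → ℂ)) →ₗ[ℂ]
        ⋀[ℂ]^n (Fin (2 * n + 1) → ℂ),
      Function.Surjective φ ∧
      (∀ g : Matrix (Fin (2 * n + 1)) (Fin (2 * n + 1)) ℝ,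
        g ∈ Matrix.orthogonalGroup (Fin (2 * n + 1)) ℝ → g.det = 1 →
        ∀ (v : Fin (2 * n + 1) → ℂ) (ω : ⋀[ℂ]^n (Fin (2 * n + 1) → ℂ)),
          φ ((Matrix.toLin' (g.map (Complex.ofReal ·)) v) ⊗ₜ
              (expPowMap (Matrix.toLin' (g.map (Complex.ofReal ·))) n ω))
            = expPowMap (Matrix.toLin' (g.map (Complex.ofReal ·))) n (φ (v ⊗ₜ ω))) ∧
      ∃ s : (⋀[ℂ]^n (Fin (2 * n + 1) → ℂ)) →ₗ[ℂ]
          (Fin (2 * n + 1) → ℂ) ⊗[ℂ] (⋀[ℂ]^n (Fin (2 * n + 1) → ℂ)),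
        φ ∘ₗ s = LinearMap.id ∧
        ∀ g : Matrix (Fin (2 * n + 1)) (Fin (2 * n + 1)) ℝ,
          g ∈ Matrix.orthogonalGroup (Fin (2 * n + 1)) ℝ → g.det = 1 →
          ∀ x : ⋀[ℂ]^n (Fin (2 * n + 1) → ℂ),
            s (expPowMap (Matrix.toLin' (g.map (Complex.ofReal ·))) n x)
              = TensorProduct.map (Matrix.toLin' (g.map (Complex.ofReal ·)))
                  (expPowMap (Matrix.toLin' (g.map (Complex.ofReal ·))) n) (s x) := by
  have hN : 1 + n + n = 2 * n + 1 := by omega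
  have hdet : ∀ g : Matrix (Fin (2 * n + 1)) (Fin (2 * n + 1)) ℝ, g.det = 1 →
      (g.map (Complex.ofReal ·)).det = 1 := by
    intro g hg
    have := RingHom.map_det Complex.ofRealHom g
    rw [hg, map_one] at this
    exact this.symm
  have horth : ∀ g : Matrix (Fin (2 * n + 1)) (Fin (2 * n + 1)) ℝ,
      g ∈ Matrix.orthogonalGroup (Fin (2 * n + 1)) ℝ →
      (g.map (Complex.ofReal ·)) * (g.map (Complex.ofReal ·))ᵀ = 1 := by
    intro g hg
    have h1 : g * gᵀ = 1 := (Matrix.mem_orthogonalGroup_iff _ _).1 hg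
    have h2 := congrArg Complex.ofRealHom.mapMatrix h1
    rw [map_mul, map_one] at h2
    exact h2
  have hsurj := SOaux.surj hN
  have hinj : Function.Injective (SOaux.phi (2 * n + 1) n ∘ₗ SOaux.sec (2 * n + 1) n) :=
    LinearMap.injective_iff_surjective.2 hsurj
  let A := LinearEquiv.ofBijective _ ⟨hinj, hsurj⟩
  have hA : ∀ x, A x = SOaux.phi (2 * n + 1) n (SOaux.sec (2 * n + 1) n x) := fun _ => rfl
  have hφs : SOaux.phi (2 * n + 1) n ∘ₗ (SOaux.sec (2 * n + 1) n ∘ₗ A.symm.toLinearMap) =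
      LinearMap.id := by
    apply LinearMap.ext
    intro x
    exact A.apply_symm_apply x
  refine ⟨SOaux.phi (2 * n + 1) n, ?_, ?_, SOaux.sec (2 * n + 1) n ∘ₗ A.symm.toLinearMap,
    hφs, ?_⟩
  · intro y
    exact ⟨_, LinearMap.congr_fun hφs y⟩
  · intro g hg hd v ω
    exact SOaux.phi_equiv _ (hdet g hd) (horth g hg) v ω
  · intro g hg hd x
    have hphi : ∀ t, SOaux.phi (2 * n + 1) n
        (TensorProduct.map (Matrix.toLin' (g.map (Complex.ofReal ·)))
          (expPowMap (Matrix.toLin' (g.map (Complex.ofReal ·))) n) t) =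
        expPowMap (Matrix.toLin' (g.map (Complex.ofReal ·))) n (SOaux.phi (2 * n + 1) n t) := by
      intro t
      induction t using TensorProduct.induction_on with
      | zero => simp
      | tmul v ω =>
        rw [TensorProduct.map_tmul]
        exact SOaux.phi_equiv _ (hdet g hd) (horth g hg) v ω
      | add a b ha hb => simp only [map_add, ha, hb]
    have hcomm : A.symm (expPowMap (Matrix.toLin' (g.map (Complex.ofReal ·))) n x) =
        expPowMap (Matrix.toLin' (g.map (Complex.ofReal ·))) n (A.symm x) := by
      rw [LinearEquiv.symm_apply_eq, hA, SOaux.sec_equiv _ (hdet g hd) (horth g hg), hphi, ← hA,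
        A.apply_symm_apply]
    simp only [LinearMap.comp_apply, LinearEquiv.coe_coe]
    rw [hcomm, SOaux.sec_equiv _ (hdet g hd) (horth g hg)]

end
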